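/- The scalar Airy convolution operator 𝓛 on L²(ℝ), defined by (𝓛f)(x) = ∫_ℝ Ai(x+y) f(y) dy, satisfies 𝓛² = Id; in particular 𝓛 is a unitary involution with operator norm 1. -/

import Mathlib

open MeasureTheory Filter intervalIntegral

/-- A solution of the Airy equation that vanishes at `0` and decays at `+∞` is zero. -/
theorem airy_solution_eq_zero {D D' : ℝ → ℝ} (hD : ∀ x, HasDerivAt D (D' x) x)
    (hD' : ∀ x, HasDerivAt D' (x * D x) x) (h0 : D 0 = 0) (hlim : Tendsto D atTop (nhds 0)) :
    ∀ x, D x = 0 := by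
  have hsq : ∀ x, HasDerivAt (fun x => D x ^ 2) (2 * (D x * D' x)) x := fun x => by
    refine HasDerivAt.congr_deriv ((hD x).pow 2) ?_
    simp
    ring
  have hprod : ∀ x, HasDerivAt (fun x => D x * D' x) (D' x * D' x + D x * (x * D x)) x :=
    fun x => (hD x).mul (hD' x)
  have hprod_mono : MonotoneOn (fun x => D x * D' x) (Set.Ici 0) := by
    refine monotoneOn_of_deriv_nonneg (convex_Ici 0)
      (fun x _ => (hprod x).continuousAt.continuousWithinAt)
      (fun x _ => (hprod x).differentiableAt.differentiableWithinAt) fun x hx => ?_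
    rw [interior_Ici, Set.mem_Ioi] at hx
    rw [(hprod x).deriv]
    have := mul_nonneg hx.le (mul_self_nonneg (D x))
    nlinarith [mul_self_nonneg (D' x)]
  have hsq_mono : MonotoneOn (fun x => D x ^ 2) (Set.Ici 0) := by
    refine monotoneOn_of_deriv_nonneg (convex_Ici 0)
      (fun x _ => (hsq x).continuousAt.continuousWithinAt)
      (fun x _ => (hsq x).differentiableAt.differentiableWithinAt) fun x hx => ?_
    rw [interior_Ici, Set.mem_Ioi] at hx
    rw [(hsq x).deriv]
    have := hprod_mono (Set.mem_Ici.2 le_rfl) hx.le hx.le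
    simp only [h0, zero_mul] at this
    linarith
  have hpos : ∀ x, 0 ≤ x → D x = 0 := fun x hx => by
    have hle : D x ^ 2 ≤ 0 := by
      have hl : Tendsto (fun x => D x ^ 2) atTop (nhds 0) := by simpa using hlim.pow 2
      refine ge_of_tendsto hl ?_
      filter_upwards [eventually_ge_atTop x] with y hy
      exact hsq_mono hx (hx.trans hy) hy
    exact pow_eq_zero_iff two_ne_zero |>.1 (le_antisymm hle (sq_nonneg _))
  have h0' : D' 0 = 0 := by
    have h1 : HasDerivWithinAt D (D' 0) (Set.Ici 0) 0 := (hD 0).hasDerivWithinAt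
    have h2 : HasDerivWithinAt D 0 (Set.Ici 0) 0 :=
      (hasDerivWithinAt_const (0 : ℝ) (Set.Ici 0) (0 : ℝ)).congr (fun y hy => hpos y hy) h0
    exact (uniqueDiffOn_Ici (0 : ℝ) 0 Set.self_mem_Ici).eq_deriv _ h1 h2
  intro x
  rcases le_total 0 x with hx | hx
  · exact hpos x hx
  set P : ℝ → ℝ := fun x => (D x ^ 2 + D' x ^ 2) * Real.exp (x - x ^ 2 / 2) with hP
  have hPd : ∀ x, HasDerivAt P ((2 * (1 + x) * (D x * D' x) +
      (D x ^ 2 + D' x ^ 2) * (1 - x)) * Real.exp (x - x ^ 2 / 2)) x := fun x => by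
    have he : HasDerivAt (fun x : ℝ => Real.exp (x - x ^ 2 / 2))
        (Real.exp (x - x ^ 2 / 2) * (1 - x)) x := by
      refine HasDerivAt.exp ?_
      refine HasDerivAt.congr_deriv ((hasDerivAt_id x).sub (((hasDerivAt_id x).pow 2).div_const 2)) ?_
      simp
    ring_nf
    refine HasDerivAt.congr_deriv (((hsq x).add ((hD' x).pow 2)).mul he) ?_
    simp
    ring_nf
  have hPmono : MonotoneOn P (Set.Iic 0) := by
    refine monotoneOn_of_deriv_nonneg (convex_Iic 0)
      (fun x _ => (hPd x).continuousAt.continuousWithinAt)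
      (fun x _ => (hPd x).differentiableAt.differentiableWithinAt) fun x hx => ?_
    rw [interior_Iic, Set.mem_Iio] at hx
    rw [(hPd x).deriv]
    refine mul_nonneg ?_ (Real.exp_pos _).le
    nlinarith [sq_nonneg (D x + D' x), mul_nonneg (neg_nonneg.2 hx.le) (sq_nonneg (D x - D' x))]
  have hle : P x ≤ P 0 := hPmono hx Set.self_mem_Iic hx
  simp only [hP, h0, h0'] at hle
  have h3 : D x ^ 2 + D' x ^ 2 ≤ 0 := by
    by_contra! h
    have := mul_pos h (Real.exp_pos (x - x ^ 2 / 2))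
    norm_num at hle
    linarith
  have : D x ^ 2 = 0 := le_antisymm (by nlinarith [sq_nonneg (D' x)]) (sq_nonneg _)
  exact pow_eq_zero_iff two_ne_zero |>.1 this

/-- A solution of the Airy equation that decays at `+∞` is bounded on the whole line. -/
theorem airy_solution_bounded {D D' : ℝ → ℝ} (hD : ∀ x, HasDerivAt D (D' x) x)
    (hD' : ∀ x, HasDerivAt D' (x * D x) x) (hlim : Tendsto D atTop (nhds 0)) :
    ∃ C, ∀ x, |D x| ≤ C := by
  have hcont : Continuous D := continuous_iff_continuousAt.2 fun x => (hD x).continuousAt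
  set W : ℝ → ℝ := fun x => D x ^ 2 - D' x ^ 2 / x with hW
  have hWd : ∀ x, x < 0 → HasDerivAt W (D' x ^ 2 / x ^ 2) x := fun x hx => by
    refine HasDerivAt.congr_deriv (((hD x).pow 2).sub (((hD' x).pow 2).div (hasDerivAt_id x) hx.ne)) ?_
    simp
    field_simp [hx.ne]
    ring
  have hWmono : MonotoneOn W (Set.Iic (-1)) := by
    have hneg : ∀ x ∈ Set.Iic (-1 : ℝ), x < 0 := fun x hx => lt_of_le_of_lt hx (by norm_num)
    refine monotoneOn_of_deriv_nonneg (convex_Iic _)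
      (fun x hx => (hWd x (hneg x hx)).continuousAt.continuousWithinAt)
      (fun x hx => (hWd x (hneg x (interior_subset hx))).differentiableAt.differentiableWithinAt)
      fun x hx => ?_
    rw [(hWd x (hneg x (interior_subset hx))).deriv]
    positivity
  obtain ⟨N, hN⟩ := eventually_atTop.1 ((hlim.abs).eventually_le_const
    (show |(0 : ℝ)| < 1 by norm_num))
  obtain ⟨B, hB⟩ := (isCompact_Icc (a := (-1 : ℝ)) (b := N)).exists_bound_of_continuousOn
    hcont.continuousOn
  refine ⟨max (max 1 B) (Real.sqrt (W (-1))), fun x => ?_⟩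
  rcases le_total x (-1) with hx | hx
  · refine le_max_of_le_right (Real.abs_le_sqrt ?_)
    have h1 : W x ≤ W (-1) := hWmono hx Set.self_mem_Iic hx
    have h2 : D' x ^ 2 / x ≤ 0 := div_nonpos_of_nonneg_of_nonpos (sq_nonneg _) (by linarith)
    simp only [hW] at h1 ⊢
    linarith
  · rcases le_total x N with hxN | hxN
    · exact le_max_of_le_left (le_max_of_le_right (hB x ⟨hx, hxN⟩))
    · exact le_max_of_le_left (le_max_of_le_left (hN x hxN))

theorem exists_mul_le_mul_cube_add {c : ℝ} (hc : 0 < c) (b : ℝ) :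
    ∃ K, 0 ≤ K ∧ ∀ t, 0 ≤ t → b * t ≤ c * t ^ 3 + K := by
  refine ⟨|b| * (|b| / c + 1), by positivity, fun t ht => ?_⟩
  have h1 : b * t ≤ |b| * t := mul_le_mul_of_nonneg_right (le_abs_self b) ht
  rcases le_total t (|b| / c + 1) with h | h
  · have h2 := mul_le_mul_of_nonneg_left h (abs_nonneg b)
    have h3 : 0 ≤ c * t ^ 3 := by positivity
    linarith
  · have hbc : 0 ≤ |b| / c := by positivity
    have ht1 : 1 ≤ t := by linarith
    have h2 : |b| ≤ c * t := by
      rw [← div_le_iff₀' hc]; linarith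
    have h3 : |b| * t ≤ c * t * t := mul_le_mul_of_nonneg_right h2 ht
    have h4 : c * t ^ 2 ≤ c * t ^ 3 :=
      mul_le_mul_of_nonneg_left (pow_le_pow_right₀ ht1 (by norm_num)) hc.le
    have : 0 ≤ |b| * (|b| / c + 1) := by positivity
    nlinarith

theorem integrableOn_pow_mul_exp_sub_cube (k : ℕ) {c : ℝ} (hc : 0 < c) (b : ℝ) :
    IntegrableOn (fun t : ℝ => t ^ k * Real.exp (b * t - c * t ^ 3)) (Set.Ioi 0) := by
  obtain ⟨K, -, hK⟩ := exists_mul_le_mul_cube_add (half_pos hc) b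
  have h := (integrableOn_rpow_mul_exp_neg_mul_rpow (p := 3) (s := k) (b := c / 2)
    (by have := k.cast_nonneg (α := ℝ); linarith) (by norm_num) (half_pos hc)).const_mul
      (Real.exp K)
  refine Integrable.mono' h (by fun_prop) ?_
  filter_upwards [ae_restrict_mem measurableSet_Ioi] with t ht
  have ht0 : (0 : ℝ) ≤ t := le_of_lt ht
  rw [Real.norm_of_nonneg (by positivity), Real.rpow_natCast, mul_left_comm, ← Real.exp_add]
  refine mul_le_mul_of_nonneg_left (Real.exp_le_exp.2 ?_) (by positivity)
  have h3 : t ^ (3 : ℝ) = t ^ 3 := by exact_mod_cast Real.rpow_natCast t 3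
  rw [h3]
  linarith [hK t ht0]

/-- The Airy integrand `exp (i (ζ³ / 3 + x ζ))` at `ζ = w t`. -/
noncomputable def airyPhase (w : ℂ) (x t : ℝ) : ℂ :=
  Complex.exp (Complex.I * (w ^ 3 * t ^ 3 / 3 + x * w * t))

theorem norm_airyPhase (w : ℂ) (x t : ℝ) :
    ‖airyPhase w x t‖ = Real.exp (-(x * w.im) * t - (w ^ 3).im / 3 * t ^ 3) := by
  rw [airyPhase, Complex.norm_exp]
  congr 1
  have h1 : w ^ 3 * (t : ℂ) ^ 3 / 3 = w ^ 3 * ((t ^ 3 / 3 : ℝ) : ℂ) := by push_cast; ring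
  have h2 : (x : ℂ) * w * t = w * ((x * t : ℝ) : ℂ) := by push_cast; ring
  rw [h1, h2, Complex.I_mul_re, Complex.add_im, Complex.im_mul_ofReal, Complex.im_mul_ofReal]
  ring

@[fun_prop]
theorem continuous_airyPhase {X : Type*} [TopologicalSpace X] {w : X → ℂ} {x t : X → ℝ}
    (hw : Continuous w) (hx : Continuous x) (ht : Continuous t) :
    Continuous (fun p => airyPhase (w p) (x p) (t p)) := by
  unfold airyPhase
  fun_prop

theorem integrableOn_pow_mul_airyPhase (k : ℕ) {w : ℂ} (hw : 0 < (w ^ 3).im) (x : ℝ) :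
    IntegrableOn (fun t : ℝ => (t : ℂ) ^ k * airyPhase w x t) (Set.Ioi 0) := by
  refine Integrable.mono' (integrableOn_pow_mul_exp_sub_cube k (c := (w ^ 3).im / 3) (by positivity)
    (-(x * w.im))) (Continuous.aestronglyMeasurable (by fun_prop)) ?_
  filter_upwards [ae_restrict_mem measurableSet_Ioi] with t ht
  rw [norm_mul, norm_airyPhase, norm_pow, Complex.norm_of_nonneg (le_of_lt ht)]

theorem hasDerivAt_airyPhase_left (w : ℂ) (x t : ℝ) :
    HasDerivAt (fun x => airyPhase w x t) (Complex.I * w * t * airyPhase w x t) x := by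
  have h : HasDerivAt (fun x : ℝ => Complex.I * (w ^ 3 * t ^ 3 / 3 + x * w * t))
      (Complex.I * (1 * w * t)) x :=
    (((Complex.ofRealCLM.hasDerivAt (x := x)).mul_const w).mul_const (t : ℂ)).const_add _
      |>.const_mul _
  refine h.cexp.congr_deriv ?_
  simp only [airyPhase]; ring

theorem hasDerivAt_airyPhase_right (w : ℂ) (x t : ℝ) :
    HasDerivAt (fun t => airyPhase w x t)
      (Complex.I * (w ^ 3 * t ^ 2 + x * w) * airyPhase w x t) t := by
  have h : HasDerivAt (fun z : ℂ => Complex.I * (w ^ 3 * z ^ 3 / 3 + x * w * z))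
      (Complex.I * (w ^ 3 * (3 * (t : ℂ) ^ 2) / 3 + x * w * 1)) (t : ℂ) := by
    refine HasDerivAt.const_mul _ (HasDerivAt.add ?_ ((hasDerivAt_id _).const_mul _))
    refine HasDerivAt.div_const (HasDerivAt.const_mul _ ?_) 3
    simpa using hasDerivAt_pow 3 (t : ℂ)
  refine h.cexp.comp_ofReal.congr_deriv ?_
  simp only [airyPhase]; ring

theorem hasDerivAt_integral_pow_mul_airyPhase (k : ℕ) {w : ℂ} (hw : 0 < (w ^ 3).im) (x : ℝ) :
    HasDerivAt (fun x => ∫ t in Set.Ioi (0 : ℝ), (t : ℂ) ^ k * airyPhase w x t)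
      (Complex.I * w * ∫ t in Set.Ioi (0 : ℝ), (t : ℂ) ^ (k + 1) * airyPhase w x t) x := by
  have key := (hasDerivAt_integral_of_dominated_loc_of_deriv_le
    (μ := volume.restrict (Set.Ioi (0 : ℝ)))
    (F := fun x t => (t : ℂ) ^ k * airyPhase w x t)
    (F' := fun x t => (t : ℂ) ^ k * (Complex.I * w * t * airyPhase w x t))
    (bound := fun t => ‖w‖ * (t ^ (k + 1) * Real.exp ((|x| + 1) * |w.im| * t
      - (w ^ 3).im / 3 * t ^ 3)))
    (Metric.ball_mem_nhds x one_pos)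
    (Eventually.of_forall fun x => Continuous.aestronglyMeasurable (by fun_prop))
    (integrableOn_pow_mul_airyPhase k hw x)
    (Continuous.aestronglyMeasurable (by fun_prop)) ?_
    ((integrableOn_pow_mul_exp_sub_cube (k + 1) (by positivity) _).const_mul _)
    (Eventually.of_forall fun t y _ => (hasDerivAt_airyPhase_left w y t).const_mul _)).2
  · refine key.congr_deriv ?_
    rw [← MeasureTheory.integral_const_mul]
    congr 1; ext t; ring
  · filter_upwards [ae_restrict_mem measurableSet_Ioi] with t ht y hy
    have ht0 : (0 : ℝ) ≤ t := le_of_lt ht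
    rw [norm_mul, norm_mul, norm_mul, norm_mul, norm_airyPhase, norm_pow,
      Complex.norm_of_nonneg ht0, Complex.norm_I]
    have hb : -(y * w.im) ≤ (|x| + 1) * |w.im| := by
      have h1 : |y| ≤ |x| + 1 := by
        have := abs_sub_abs_le_abs_sub y x
        rw [Metric.mem_ball, Real.dist_eq] at hy
        linarith
      calc -(y * w.im) ≤ |y * w.im| := neg_le_abs _
        _ = |y| * |w.im| := abs_mul _ _
        _ ≤ _ := by gcongr
    have he : Real.exp (-(y * w.im) * t - (w ^ 3).im / 3 * t ^ 3) ≤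
        Real.exp ((|x| + 1) * |w.im| * t - (w ^ 3).im / 3 * t ^ 3) := by gcongr
    calc t ^ k * (1 * ‖w‖ * t * Real.exp (-(y * w.im) * t - (w ^ 3).im / 3 * t ^ 3))
        = ‖w‖ * (t ^ (k + 1) * Real.exp (-(y * w.im) * t - (w ^ 3).im / 3 * t ^ 3)) := by ring
      _ ≤ _ := by gcongr

theorem tendsto_pow_mul_exp_sub_cube (k : ℕ) {c : ℝ} (hc : 0 < c) (b : ℝ) :
    Tendsto (fun t : ℝ => t ^ k * Real.exp (b * t - c * t ^ 3)) atTop (nhds 0) := by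
  obtain ⟨K, -, hK⟩ := exists_mul_le_mul_cube_add hc (b + 1)
  have h := (Real.tendsto_pow_mul_exp_neg_atTop_nhds_zero k).mul_const (Real.exp K)
  rw [zero_mul] at h
  refine squeeze_zero' ?_ ?_ h
  · filter_upwards [eventually_ge_atTop 0] with t ht
    positivity
  · filter_upwards [eventually_ge_atTop 0] with t ht
    rw [mul_assoc, ← Real.exp_add]
    gcongr
    linarith [hK t ht]

theorem tendsto_pow_mul_airyPhase (k : ℕ) {w : ℂ} (hw : 0 < (w ^ 3).im) (x : ℝ) :
    Tendsto (fun t : ℝ => (t : ℂ) ^ k * airyPhase w x t) atTop (nhds 0) := by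
  rw [tendsto_zero_iff_norm_tendsto_zero]
  refine (tendsto_pow_mul_exp_sub_cube k (c := (w ^ 3).im / 3) (by positivity)
    (-(x * w.im))).congr' ?_
  filter_upwards [eventually_ge_atTop 0] with t ht
  rw [norm_mul, norm_airyPhase, norm_pow, Complex.norm_of_nonneg ht]

/-- The integral of the Airy integrand along the ray from `0` in the direction `w`. -/
noncomputable def airyContour (w : ℂ) (x : ℝ) : ℂ :=
  ∫ t in Set.Ioi (0 : ℝ), w * airyPhase w x t

theorem airyContour_eq (w : ℂ) (x : ℝ) :
    airyContour w x = w * ∫ t in Set.Ioi (0 : ℝ), (t : ℂ) ^ 0 * airyPhase w x t := by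
  simp only [airyContour, pow_zero, one_mul, MeasureTheory.integral_const_mul]

theorem hasDerivAt_airyContour {w : ℂ} (hw : 0 < (w ^ 3).im) (x : ℝ) :
    HasDerivAt (airyContour w)
      (Complex.I * w ^ 2 * ∫ t in Set.Ioi (0 : ℝ), (t : ℂ) ^ 1 * airyPhase w x t) x := by
  rw [funext (airyContour_eq w)]
  refine ((hasDerivAt_integral_pow_mul_airyPhase 0 hw x).const_mul w).congr_deriv ?_
  ring

/-- The ray integral solves the inhomogeneous Airy equation `y'' = x y - i`. -/
theorem hasDerivAt_deriv_airyContour {w : ℂ} (hw : 0 < (w ^ 3).im) (x : ℝ) :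
    HasDerivAt
      (fun x => Complex.I * w ^ 2 * ∫ t in Set.Ioi (0 : ℝ), (t : ℂ) ^ 1 * airyPhase w x t)
      (x * airyContour w x - Complex.I) x := by
  refine ((hasDerivAt_integral_pow_mul_airyPhase 1 hw x).const_mul _).congr_deriv ?_
  have hint : IntegrableOn (fun t : ℝ => Complex.I * (w ^ 3 * t ^ 2 + x * w) * airyPhase w x t)
      (Set.Ioi 0) := by
    refine (((integrableOn_pow_mul_airyPhase 2 hw x).const_mul (Complex.I * w ^ 3)).add
      ((integrableOn_pow_mul_airyPhase 0 hw x).const_mul (Complex.I * (x * w)))).congr ?_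
    filter_upwards with t
    simp only [Pi.add_apply]; ring
  have h0 := integral_Ioi_of_hasDerivAt_of_tendsto' (a := 0)
    (fun t _ => hasDerivAt_airyPhase_right w x t) hint
    (by simpa using tendsto_pow_mul_airyPhase 0 hw x)
  have h1 : ∫ t in Set.Ioi (0 : ℝ), Complex.I * (w ^ 3 * t ^ 2 + x * w) * airyPhase w x t =
      (Complex.I * w ^ 3) * (∫ t in Set.Ioi (0 : ℝ), (t : ℂ) ^ 2 * airyPhase w x t) +
      (Complex.I * (x * w)) * ∫ t in Set.Ioi (0 : ℝ), (t : ℂ) ^ 0 * airyPhase w x t := by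
    rw [← MeasureTheory.integral_const_mul, ← MeasureTheory.integral_const_mul,
      ← MeasureTheory.integral_add ((integrableOn_pow_mul_airyPhase 2 hw x).const_mul _)
        ((integrableOn_pow_mul_airyPhase 0 hw x).const_mul _)]
    congr 1; ext t; ring
  rw [h1] at h0
  have h2 : airyPhase w x 0 = 1 := by simp [airyPhase]
  rw [h2] at h0
  rw [airyContour_eq]
  linear_combination Complex.I * h0 - (x * w * ∫ t in Set.Ioi (0 : ℝ), (t : ℂ) ^ 0 * airyPhase w x t) * Complex.I_sq

theorem tendsto_airyContour_atTop {w : ℂ} (hw : 0 < (w ^ 3).im) (hw' : 0 < w.im) :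
    Tendsto (airyContour w) atTop (nhds 0) := by
  have h : Tendsto (airyContour w) atTop (nhds (∫ _ in Set.Ioi (0 : ℝ), (0 : ℂ))) := by
    refine tendsto_integral_filter_of_dominated_convergence
      (fun t => ‖w‖ * (t ^ 0 * Real.exp (0 * t - (w ^ 3).im / 3 * t ^ 3)))
      (Eventually.of_forall fun x => Continuous.aestronglyMeasurable (by fun_prop)) ?_
      ((integrableOn_pow_mul_exp_sub_cube 0 (by positivity) _).const_mul _) ?_
    · filter_upwards [eventually_ge_atTop 0] with x hx
      filter_upwards [ae_restrict_mem measurableSet_Ioi] with t ht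
      have ht0 : (0 : ℝ) ≤ t := le_of_lt ht
      rw [norm_mul, norm_airyPhase, pow_zero, one_mul]
      gcongr
      have := mul_nonneg hx hw'.le
      linarith
    · filter_upwards [ae_restrict_mem measurableSet_Ioi] with t ht
      rw [tendsto_zero_iff_norm_tendsto_zero]
      simp only [norm_mul, norm_airyPhase]
      rw [← mul_zero ‖w‖]
      refine Tendsto.const_mul _ (Real.tendsto_exp_atBot.comp ?_)
      refine tendsto_atBot_add_const_right _ _ ?_
      have : Tendsto (fun x : ℝ => x * (w.im * t)) atTop atTop :=
        tendsto_id.atTop_mul_const (mul_pos hw' ht)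
      refine (tendsto_neg_atTop_atBot.comp this).congr fun x => ?_
      simp only [Function.comp]; ring
  simpa using h

theorem one_add_mul_I_im (s : ℝ) : (1 + s * Complex.I : ℂ).im = s := by simp

theorem one_add_mul_I_cube (s : ℝ) : (1 + s * Complex.I : ℂ) ^ 3 =
    ((1 - 3 * s ^ 2 : ℝ) : ℂ) + ((s * (3 - s ^ 2) : ℝ) : ℂ) * Complex.I := by
  push_cast
  linear_combination (3 * s ^ 2 + s ^ 3 * Complex.I : ℂ) * Complex.I_sq

theorem one_add_mul_I_cube_im (s : ℝ) : ((1 + s * Complex.I : ℂ) ^ 3).im = s * (3 - s ^ 2) := by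
  rw [one_add_mul_I_cube, Complex.add_im, Complex.ofReal_im, Complex.im_ofReal_mul, Complex.I_im]
  ring

theorem one_add_mul_I_cube_im_ge {s : ℝ} (hs : s ∈ Set.Ioo (0 : ℝ) 1) :
    2 * s ≤ ((1 + s * Complex.I : ℂ) ^ 3).im := by
  rw [one_add_mul_I_cube_im]
  nlinarith [hs.1, hs.2, mul_pos hs.1 (sub_pos.2 hs.2)]

theorem one_add_mul_I_cube_im_pos {s : ℝ} (hs : s ∈ Set.Ioo (0 : ℝ) 1) :
    0 < ((1 + s * Complex.I : ℂ) ^ 3).im :=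
  lt_of_lt_of_le (by linarith [hs.1]) (one_add_mul_I_cube_im_ge hs)

theorem norm_one_add_mul_I_le {s : ℝ} (hs : s ∈ Set.Ioo (0 : ℝ) 1) :
    ‖(1 + s * Complex.I : ℂ)‖ ≤ 2 := by
  refine (norm_add_le _ _).trans ?_
  rw [norm_one, norm_mul, Complex.norm_I, Complex.norm_of_nonneg hs.1.le]
  linarith [hs.2]

theorem hasDerivAt_mul_airyPhase_dir (w : ℂ) (x t : ℝ) :
    HasDerivAt (fun w => w * airyPhase w x t)
      (airyPhase w x t + t * (Complex.I * (w ^ 3 * t ^ 2 + x * w) * airyPhase w x t)) w := by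
  have h : HasDerivAt (fun w : ℂ => Complex.I * (w ^ 3 * t ^ 3 / 3 + x * w * t))
      (Complex.I * ((3 * w ^ 2) * t ^ 3 / 3 + x * 1 * t)) w := by
    refine HasDerivAt.const_mul _ (HasDerivAt.add ?_
      (((hasDerivAt_id _).const_mul _).mul_const _))
    refine HasDerivAt.div_const (HasDerivAt.mul_const ?_ _) 3
    simpa using hasDerivAt_pow 3 w
  refine ((hasDerivAt_id w).mul h.cexp).congr_deriv ?_
  simp only [airyPhase, id]; ring

theorem integral_deriv_mul_airyPhase {w : ℂ} (hw : 0 < (w ^ 3).im) (x : ℝ) :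
    ∫ t in Set.Ioi (0 : ℝ), (airyPhase w x t +
      t * (Complex.I * (w ^ 3 * t ^ 2 + x * w) * airyPhase w x t)) = 0 := by
  have hint : IntegrableOn (fun t : ℝ => airyPhase w x t +
      t * (Complex.I * (w ^ 3 * t ^ 2 + x * w) * airyPhase w x t)) (Set.Ioi 0) := by
    refine (((integrableOn_pow_mul_airyPhase 0 hw x).add
      ((integrableOn_pow_mul_airyPhase 3 hw x).const_mul (Complex.I * w ^ 3))).add
      ((integrableOn_pow_mul_airyPhase 1 hw x).const_mul (Complex.I * (x * w)))).congr ?_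
    filter_upwards with t
    simp only [Pi.add_apply]; ring
  have h := integral_Ioi_of_hasDerivAt_of_tendsto' (a := 0)
    (f := fun t : ℝ => (t : ℂ) * airyPhase w x t)
    (fun t _ => (((Complex.ofRealCLM.hasDerivAt (x := t)).mul
      (hasDerivAt_airyPhase_right w x t)).congr_deriv (by simp))) hint
    (by simpa using tendsto_pow_mul_airyPhase 1 hw x)
  simpa using h

theorem hasDerivAt_airyContour_dir (x : ℝ) {s : ℝ} (hs : s ∈ Set.Ioo (0 : ℝ) 1) :
    HasDerivAt (fun s : ℝ => airyContour (1 + s * Complex.I) x) 0 s := by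
  have hmem : Set.Ioo (s / 2) 1 ∈ nhds s := Ioo_mem_nhds (by linarith [hs.1]) hs.2
  have hc : 0 < s / 3 := by linarith [hs.1]
  have hint := fun k => integrableOn_pow_mul_exp_sub_cube k hc |x|
  have hbound : Integrable (fun t => t ^ 0 * Real.exp (|x| * t - s / 3 * t ^ 3) +
      8 * (t ^ 3 * Real.exp (|x| * t - s / 3 * t ^ 3)) +
      2 * |x| * (t ^ 1 * Real.exp (|x| * t - s / 3 * t ^ 3))) (volume.restrict (Set.Ioi 0)) :=
    ((hint 0).add ((hint 3).const_mul 8)).add ((hint 1).const_mul (2 * |x|))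
  have key := (hasDerivAt_integral_of_dominated_loc_of_deriv_le
    (μ := volume.restrict (Set.Ioi (0 : ℝ)))
    (F := fun (s : ℝ) t => (1 + s * Complex.I) * airyPhase (1 + s * Complex.I) x t)
    (F' := fun (s : ℝ) t => (airyPhase (1 + s * Complex.I) x t + t * (Complex.I *
      ((1 + s * Complex.I) ^ 3 * t ^ 2 + x * (1 + s * Complex.I)) *
        airyPhase (1 + s * Complex.I) x t)) * Complex.I)
    hmem
    (Eventually.of_forall fun s => Continuous.aestronglyMeasurable (by fun_prop))
    (by simpa using
      (integrableOn_pow_mul_airyPhase 0 (one_add_mul_I_cube_im_pos hs) x).const_mul _)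
    (Continuous.aestronglyMeasurable (by fun_prop)) ?_
    hbound
    (Eventually.of_forall fun t r _ => ?_)).2
  · refine key.congr_deriv ?_
    rw [MeasureTheory.integral_mul_const,
      integral_deriv_mul_airyPhase (one_add_mul_I_cube_im_pos hs) x, zero_mul]
  · filter_upwards [ae_restrict_mem measurableSet_Ioi] with t ht r hr
    have ht0 : (0 : ℝ) ≤ t := le_of_lt ht
    have hr' : r ∈ Set.Ioo (0 : ℝ) 1 := ⟨by linarith [hr.1, hs.1], hr.2⟩
    have hE : ‖airyPhase (1 + r * Complex.I) x t‖ ≤ Real.exp (|x| * t - s / 3 * t ^ 3) := by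
      rw [norm_airyPhase, one_add_mul_I_im]
      have h1 : -(x * r) ≤ |x| := by
        refine (neg_le_abs _).trans ?_
        rw [abs_mul, abs_of_pos hr'.1]
        exact mul_le_of_le_one_right (abs_nonneg _) hr.2.le
      have h2 := one_add_mul_I_cube_im_ge hr'
      have h3 : s / 3 ≤ ((1 + r * Complex.I : ℂ) ^ 3).im / 3 := by linarith [hr.1]
      gcongr
    have hW := norm_one_add_mul_I_le hr'
    set E := Real.exp (|x| * t - s / 3 * t ^ 3)
    rw [norm_mul, Complex.norm_I, mul_one]
    refine (norm_add_le _ _).trans ?_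
    rw [norm_mul, norm_mul, norm_mul, Complex.norm_I, one_mul, Complex.norm_of_nonneg ht0]
    have h4 : ‖(1 + r * Complex.I : ℂ) ^ 3 * t ^ 2 + x * (1 + r * Complex.I)‖ ≤
        2 ^ 3 * t ^ 2 + |x| * 2 := by
      refine (norm_add_le _ _).trans ?_
      rw [norm_mul, norm_mul, norm_pow, norm_pow, Complex.norm_of_nonneg ht0, Complex.norm_real,
        Real.norm_eq_abs]
      gcongr
    calc _ ≤ E + t * ((2 ^ 3 * t ^ 2 + |x| * 2) * E) := by gcongr
      _ = _ := by ring
  · have h1 : HasDerivAt (fun s : ℝ => (1 + s * Complex.I : ℂ)) Complex.I r := by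
      simpa using ((Complex.ofRealCLM.hasDerivAt (x := r)).mul_const Complex.I).const_add 1
    exact (hasDerivAt_mul_airyPhase_dir (1 + r * Complex.I) x t).comp r h1

theorem airyContour_dir_eq (x : ℝ) {s s' : ℝ} (hs : s ∈ Set.Ioo (0 : ℝ) 1)
    (hs' : s' ∈ Set.Ioo (0 : ℝ) 1) :
    airyContour (1 + s * Complex.I) x = airyContour (1 + s' * Complex.I) x :=
  isOpen_Ioo.is_const_of_deriv_eq_zero isPreconnected_Ioo
    (f := fun s : ℝ => airyContour (1 + s * Complex.I) x)
    (fun _ h => (hasDerivAt_airyContour_dir x h).differentiableAt.differentiableWithinAt)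
    (fun _ h => (hasDerivAt_airyContour_dir x h).deriv) hs hs'

theorem rpow_mul_Gamma_four_thirds :
    (8 / 9 * (3 : ℝ) ^ (-(1 / 2) : ℝ)) ^ (-1 / 3 : ℝ) * Real.Gamma (1 / 3 + 1) =
      Real.pi * (1 / (3 ^ ((2 : ℝ) / 3) * Real.Gamma (2 / 3))) := by
  have h3 : (0 : ℝ) < 3 := by norm_num
  have hb : 8 / 9 * (3 : ℝ) ^ (-(1 / 2) : ℝ) = (2 * (3 : ℝ) ^ (-(5 / 6) : ℝ)) ^ (3 : ℝ) := by
    rw [Real.mul_rpow (by norm_num) (by positivity), ← Real.rpow_mul h3.le,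
      show (-(5 / 6) * 3 : ℝ) = -(1 / 2) - 2 by norm_num, Real.rpow_sub h3]
    norm_num
    ring
  have hsin : Real.sin (Real.pi * (1 / 3)) = (3 : ℝ) ^ (1 / 2 : ℝ) / 2 := by
    rw [mul_one_div, Real.sin_pi_div_three, Real.sqrt_eq_rpow]
  have hG := Real.Gamma_mul_Gamma_one_sub (1 / 3)
  rw [hsin, show (1 - 1 / 3 : ℝ) = 2 / 3 by norm_num] at hG
  have hG2 : 0 < Real.Gamma (2 / 3) := Real.Gamma_pos_of_pos (by norm_num)
  rw [hb, ← Real.rpow_mul (by positivity), Real.Gamma_add_one (by norm_num),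
    show (3 * (-1 / 3) : ℝ) = -1 by norm_num, Real.rpow_neg_one, mul_inv,
    ← Real.rpow_neg h3.le, neg_neg]
  have hp : (3 : ℝ) ^ (5 / 6 : ℝ) * 3 ^ (2 / 3 : ℝ) = 3 * 3 ^ (1 / 2 : ℝ) := by
    rw [← Real.rpow_add h3, ← Real.rpow_one_add' h3.le (by norm_num)]
    norm_num
  have hq : (0 : ℝ) < 3 ^ (1 / 2 : ℝ) := by positivity
  have hr : (0 : ℝ) < 3 ^ (2 / 3 : ℝ) := by positivity
  have hG1 : Real.Gamma (1 / 3) * Real.Gamma (2 / 3) * 3 ^ (1 / 2 : ℝ) = 2 * Real.pi := by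
    rw [hG]; field_simp
  rw [mul_one_div, eq_div_iff (by positivity)]
  linear_combination (Real.Gamma (1 / 3) * Real.Gamma (2 / 3) / 6) * hp + hG1 / 2

theorem airyContour_zero_re {s : ℝ} (hs : s ∈ Set.Ioo (0 : ℝ) 1) :
    (airyContour (1 + s * Complex.I) 0).re =
      Real.pi * (1 / (3 ^ ((2 : ℝ) / 3) * Real.Gamma (2 / 3))) := by
  set r : ℝ := (3 : ℝ) ^ (-(1 / 2) : ℝ) with hr
  have hr0 : 0 < r := by positivity
  have hr2 : r ^ 2 = 1 / 3 := by
    rw [hr, ← Real.rpow_mul_natCast (by norm_num)]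
    norm_num [Real.rpow_neg_one]
  have hr1 : r < 1 := by nlinarith
  have hphase : ∀ t : ℝ, airyPhase (1 + r * Complex.I) 0 t =
      ((Real.exp (-(8 / 9 * r) * t ^ (3 : ℝ)) : ℝ) : ℂ) := fun t => by
    have h3 : t ^ (3 : ℝ) = t ^ 3 := by exact_mod_cast Real.rpow_natCast t 3
    rw [airyPhase, one_add_mul_I_cube, hr2, h3, Complex.ofReal_exp]
    congr 1
    push_cast
    linear_combination (8 / 9 * r * t ^ 3 : ℂ) * Complex.I_sq
  rw [airyContour_dir_eq 0 hs ⟨hr0, hr1⟩, airyContour, MeasureTheory.integral_const_mul]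
  simp_rw [hphase]
  rw [integral_complex_ofReal, Complex.re_mul_ofReal,
    integral_exp_neg_mul_rpow (by norm_num) (by positivity), rpow_mul_Gamma_four_thirds]
  simp

/-- The Airy function as the real part of a ray integral in any direction `1 + i s`, `0 < s < 1`. -/
theorem airy_eq_re_airyContour {A A' : ℝ → ℝ} (hA : ∀ x, HasDerivAt A (A' x) x)
    (hA' : ∀ x, HasDerivAt A' (x * A x) x) (hlim : Tendsto A atTop (nhds 0))
    (h0 : A 0 = 1 / (3 ^ ((2 : ℝ) / 3) * Real.Gamma (2 / 3)))
    {s : ℝ} (hs : s ∈ Set.Ioo (0 : ℝ) 1) (x : ℝ) :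
    A x = Real.pi⁻¹ * (airyContour (1 + s * Complex.I) x).re := by
  have hw := one_add_mul_I_cube_im_pos hs
  have hw' : 0 < (1 + s * Complex.I : ℂ).im := by rw [one_add_mul_I_im]; exact hs.1
  have key := airy_solution_eq_zero
    (D := fun x => A x - Real.pi⁻¹ * (airyContour (1 + s * Complex.I) x).re)
    (fun x => (hA x).sub
      ((Complex.reCLM.hasFDerivAt.comp_hasDerivAt x (hasDerivAt_airyContour hw x)).const_mul _))
    (fun x => ((hA' x).sub ((Complex.reCLM.hasFDerivAt.comp_hasDerivAt x
      (hasDerivAt_deriv_airyContour hw x)).const_mul _)).congr_deriv ?_) ?_ ?_ x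
  · linarith
  · simp; ring
  · rw [airyContour_zero_re hs, h0, ← mul_assoc, inv_mul_cancel₀ Real.pi_ne_zero, one_mul, sub_self]
  · have h := (Complex.continuous_re.tendsto _).comp (tendsto_airyContour_atTop hw hw')
    simpa using hlim.sub (h.const_mul Real.pi⁻¹)

/-- The Fourier–Laplace transform `∫ f(y) exp (i ζ y) dy`. -/
noncomputable def fourierLaplace (f : ℝ → ℝ) (ζ : ℂ) : ℂ :=
  ∫ y, (f y : ℂ) * Complex.exp (Complex.I * ζ * y)

theorem norm_mul_exp_I_mul_le {f : ℝ → ℝ} {M : ℝ} (hM : ∀ y, f y ≠ 0 → |y| ≤ M) {ζ : ℂ}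
    (hζ : 0 ≤ ζ.im) (y : ℝ) :
    ‖(f y : ℂ) * Complex.exp (Complex.I * ζ * y)‖ ≤ Real.exp (M * ζ.im) * |f y| := by
  by_cases hy : f y = 0
  · simp [hy]
  · rw [norm_mul, Complex.norm_exp, Complex.norm_real, Real.norm_eq_abs, mul_comm, mul_assoc,
      Complex.I_mul_re, Complex.im_mul_ofReal]
    gcongr
    have h1 := neg_le_of_abs_le (hM y hy)
    nlinarith

theorem norm_fourierLaplace_le {f : ℝ → ℝ} (hf : Integrable f) {M : ℝ}
    (hM : ∀ y, f y ≠ 0 → |y| ≤ M) {ζ : ℂ} (hζ : 0 ≤ ζ.im) :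
    ‖fourierLaplace f ζ‖ ≤ Real.exp (M * ζ.im) * ∫ y, |f y| := by
  rw [← MeasureTheory.integral_const_mul]
  exact norm_integral_le_of_norm_le (hf.abs.const_mul _)
    (Eventually.of_forall fun y => norm_mul_exp_I_mul_le hM hζ y)

theorem continuous_fourierLaplace {f : ℝ → ℝ} (hf : Continuous f) {M : ℝ}
    (hM : ∀ y, f y ≠ 0 → |y| ≤ M) : Continuous (fourierLaplace f) := by
  have h : fourierLaplace f =
      fun ζ => ∫ y in Set.Icc (-M) M, (f y : ℂ) * Complex.exp (Complex.I * ζ * y) := by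
    funext ζ
    refine (setIntegral_eq_integral_of_forall_compl_eq_zero fun y hy => ?_).symm
    by_contra hne
    exact hy (abs_le.1 (hM y fun h => hne (by simp [h])))
  rw [h]
  exact continuous_parametric_integral_of_continuous
    (f := fun (ζ : ℂ) (y : ℝ) => (f y : ℂ) * Complex.exp (Complex.I * ζ * y))
    (by unfold Function.uncurry; fun_prop) isCompact_Icc

theorem fourierLaplace_deriv_deriv {f : ℝ → ℝ} (hf : ContDiff ℝ 2 f) (hs : HasCompactSupport f)
    (ζ : ℂ) : fourierLaplace (deriv (deriv f)) ζ = -ζ ^ 2 * fourierLaplace f ζ := by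
  have hf1 : ContDiff ℝ 1 (deriv f) := hf.deriv'
  have hc2 : Continuous (deriv (deriv f)) := hf1.continuous_deriv le_rfl
  have hd0 : ∀ y, HasDerivAt f (deriv f y) y := fun y =>
    (hf.differentiable (by norm_num) y).hasDerivAt
  have hd1 : ∀ y, HasDerivAt (deriv f) (deriv (deriv f) y) y := fun y =>
    (hf1.differentiable (by norm_num) y).hasDerivAt
  have hc0 := hf.continuous
  have hc1 := hf1.continuous
  have hint : ∀ {g : ℝ → ℝ}, Continuous g → HasCompactSupport g →
      Integrable fun y => (g y : ℂ) * Complex.exp (Complex.I * ζ * y) := fun {g} hg hgs =>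
    Continuous.integrable_of_hasCompactSupport (by fun_prop)
      ((hgs.comp_left (g := fun r : ℝ => (r : ℂ)) Complex.ofReal_zero).mul_right)
  have hexp : ∀ y : ℝ, HasDerivAt (fun y : ℝ => Complex.exp (Complex.I * ζ * y))
      (Complex.exp (Complex.I * ζ * y) * (Complex.I * ζ)) y := fun y => by
    have h1 : HasDerivAt (fun y : ℝ => Complex.I * ζ * y) (Complex.I * ζ) y := by
      simpa using (Complex.ofRealCLM.hasDerivAt (x := y)).const_mul (Complex.I * ζ)
    exact h1.cexp
  have h := integral_eq_zero_of_hasDerivAt_of_integrable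
    (f := fun y : ℝ => (((deriv f y : ℝ) : ℂ) - Complex.I * ζ * f y) * Complex.exp (Complex.I * ζ * y))
    (f' := fun y : ℝ => ((deriv (deriv f) y : ℝ) : ℂ) * Complex.exp (Complex.I * ζ * y) +
      ζ ^ 2 * ((f y : ℂ) * Complex.exp (Complex.I * ζ * y)))
    (fun y => ?_) ?_ ?_
  · rw [MeasureTheory.integral_add (hint hc2 hs.deriv.deriv) ((hint hc0 hs).const_mul _),
      MeasureTheory.integral_const_mul] at h
    simp only [fourierLaplace]
    linear_combination h
  · refine ((((hd1 y).ofReal_comp).sub (((hd0 y).ofReal_comp).const_mul _)).mul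
      (hexp y)).congr_deriv ?_
    simp only [Pi.sub_apply]
    linear_combination (-ζ ^ 2 * f y * Complex.exp (Complex.I * ζ * y)) * Complex.I_sq
  · exact (hint hc2 hs.deriv.deriv).add ((hint hc0 hs).const_mul _)
  · refine ((hint hc1 hs.deriv).sub ((hint hc0 hs).const_mul (Complex.I * ζ))).congr ?_
    filter_upwards with y
    simp only [Pi.sub_apply]; ring

theorem exists_support_bound {f : ℝ → ℝ} (hs : HasCompactSupport f) :
    ∃ M, ∀ y ∈ tsupport f, |y| ≤ M := by
  simpa using hs.isCompact.exists_bound_of_continuousOn (f := id) continuousOn_id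

/-- Paley–Wiener type bound for the Fourier–Laplace transform of a test function. -/
theorem exists_norm_fourierLaplace_le {f : ℝ → ℝ} (hf : ContDiff ℝ 2 f)
    (hs : HasCompactSupport f) {M : ℝ} (hM : ∀ y ∈ tsupport f, |y| ≤ M) :
    ∃ C, 0 ≤ C ∧ ∀ ζ : ℂ, 0 ≤ ζ.im →
      ‖fourierLaplace f ζ‖ ≤ C * Real.exp (M * ζ.im) * (1 + ‖ζ‖ ^ 2)⁻¹ := by
  have hc2 : Continuous (deriv (deriv f)) :=
    ContDiff.continuous_deriv (hf.deriv' : ContDiff ℝ 1 (deriv f)) le_rfl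
  have hM0 : ∀ y, f y ≠ 0 → |y| ≤ M := fun y hy => hM y (subset_tsupport _ hy)
  have hM2 : ∀ y, deriv (deriv f) y ≠ 0 → |y| ≤ M := fun y hy =>
    hM y (closure_minimal support_deriv_subset (isClosed_tsupport f)
      (support_deriv_subset hy))
  refine ⟨(∫ y, |f y|) + ∫ y, |deriv (deriv f) y|, ?_, fun ζ hζ => ?_⟩
  · exact add_nonneg (integral_nonneg fun _ => abs_nonneg _) (integral_nonneg fun _ => abs_nonneg _)
  have h1 := norm_fourierLaplace_le (hf.continuous.integrable_of_hasCompactSupport hs) hM0 hζ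
  have h2 := norm_fourierLaplace_le (hc2.integrable_of_hasCompactSupport hs.deriv.deriv) hM2 hζ
  rw [fourierLaplace_deriv_deriv hf hs, norm_mul, norm_neg, norm_pow] at h2
  rw [← div_eq_mul_inv, le_div_iff₀ (by positivity)]
  linarith

theorem integral_airyContour_mul {f : ℝ → ℝ} (hf : Continuous f) (hs : HasCompactSupport f)
    {M : ℝ} (hM : ∀ y ∈ tsupport f, |y| ≤ M) {w : ℂ} (hw : 0 < (w ^ 3).im) (x : ℝ) :
    ∫ y, airyContour w (x + y) * f y =
      ∫ t in Set.Ioi (0 : ℝ), w * airyPhase w x t * fourierLaplace f (w * t) := by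
  have hint : Integrable (Function.uncurry fun (y t : ℝ) => w * airyPhase w (x + y) t * f y)
      (volume.prod (volume.restrict (Set.Ioi 0))) := by
    have hfi : Integrable fun y => |f y| := (hf.integrable_of_hasCompactSupport hs).abs
    have hb := hfi.mul_prod ((integrableOn_pow_mul_exp_sub_cube 0 (c := (w ^ 3).im / 3)
      (by positivity) ((|x| + M) * |w.im|)).const_mul ‖w‖)
    refine hb.mono' (Continuous.aestronglyMeasurable
      (by unfold Function.uncurry; fun_prop)) ?_
    have hae : ∀ᵐ p : ℝ × ℝ ∂(volume.prod (volume.restrict (Set.Ioi 0))), 0 < p.2 :=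
      Measure.quasiMeasurePreserving_snd.ae (ae_restrict_mem measurableSet_Ioi)
    filter_upwards [hae] with p hp
    obtain ⟨y, t⟩ := p
    simp only [Function.uncurry_apply_pair] at hp ⊢
    by_cases hy : f y = 0
    · simp [hy]
    · have hyM := hM y (subset_tsupport _ hy)
      rw [norm_mul, norm_mul, norm_airyPhase, Complex.norm_real, Real.norm_eq_abs, pow_zero,
        one_mul, mul_comm]
      have h1 : -((x + y) * w.im) ≤ (|x| + M) * |w.im| := by
        refine (neg_le_abs _).trans ?_
        rw [abs_mul]
        have := abs_add_le x y
        gcongr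
        linarith
      gcongr
  have h1 : ∀ y, airyContour w (x + y) * f y =
      ∫ t in Set.Ioi (0 : ℝ), w * airyPhase w (x + y) t * f y := fun y => by
    rw [MeasureTheory.integral_mul_const]; rfl
  simp_rw [h1]
  rw [integral_integral_swap hint]
  congr 1
  ext t
  rw [fourierLaplace, ← MeasureTheory.integral_const_mul]
  congr 1
  ext y
  have h2 : airyPhase w (x + y) t = airyPhase w x t * Complex.exp (Complex.I * (w * t) * y) := by
    rw [airyPhase, airyPhase, ← Complex.exp_add]
    congr 1; push_cast; ring
  rw [h2]; ring

theorem integrable_airyPhase_one_mul_fourierLaplace {f : ℝ → ℝ} (hf : ContDiff ℝ 2 f)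
    (hs : HasCompactSupport f) (x : ℝ) :
    Integrable fun t : ℝ => airyPhase 1 x t * fourierLaplace f t := by
  obtain ⟨M, hM⟩ := exists_support_bound hs
  obtain ⟨C, hC0, hC⟩ := exists_norm_fourierLaplace_le hf hs hM
  have hcont := continuous_fourierLaplace hf.continuous
    (fun y hy => hM y (subset_tsupport _ hy))
  refine Integrable.mono' (integrable_inv_one_add_sq.const_mul C)
    (Continuous.aestronglyMeasurable (by fun_prop)) (Eventually.of_forall fun t => ?_)
  have h := hC (t : ℂ) (by simp)
  rw [norm_mul, norm_airyPhase]
  simpa using h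

theorem tendsto_integral_airyPhase {f : ℝ → ℝ} (hf : ContDiff ℝ 2 f)
    (hs : HasCompactSupport f) (x : ℝ) :
    Tendsto (fun s : ℝ => ∫ t in Set.Ioi (0 : ℝ), (1 + s * Complex.I) *
        airyPhase (1 + s * Complex.I) x t * fourierLaplace f ((1 + s * Complex.I) * t))
      (nhdsWithin 0 (Set.Ioi 0))
      (nhds (∫ t in Set.Ioi (0 : ℝ), airyPhase 1 x t * fourierLaplace f t)) := by
  obtain ⟨M, hM⟩ := exists_support_bound hs
  obtain ⟨C, hC0, hC⟩ := exists_norm_fourierLaplace_le hf hs hM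
  obtain ⟨K, hK0, hK⟩ := exists_mul_le_mul_cube_add (c := 2 / 3) (by norm_num) (|x| + M)
  have hcont := continuous_fourierLaplace hf.continuous
    (fun y hy => hM y (subset_tsupport _ hy))
  refine tendsto_integral_filter_of_dominated_convergence
    (fun t => 2 * C * Real.exp K * (1 + t ^ 2)⁻¹)
    (Eventually.of_forall fun s => Continuous.aestronglyMeasurable (by fun_prop)) ?_
    (integrable_inv_one_add_sq.const_mul _).integrableOn ?_
  · filter_upwards [Ioo_mem_nhdsGT (one_pos (α := ℝ))] with s hs
    filter_upwards [ae_restrict_mem measurableSet_Ioi] with t ht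
    have ht0 : (0 : ℝ) ≤ t := le_of_lt ht
    have him : ((1 + s * Complex.I : ℂ) * t).im = s * t := by
      rw [Complex.im_mul_ofReal, one_add_mul_I_im]
    have hF := hC ((1 + s * Complex.I) * t) (by rw [him]; exact mul_nonneg hs.1.le ht0)
    have hW := norm_one_add_mul_I_le hs
    have hW1 : 1 ≤ ‖(1 + s * Complex.I : ℂ)‖ := by
      simpa using Complex.abs_re_le_norm (1 + s * Complex.I : ℂ)
    have hcube := one_add_mul_I_cube_im_ge hs
    have hden : (1 + ‖(1 + s * Complex.I : ℂ) * t‖ ^ 2)⁻¹ ≤ (1 + t ^ 2)⁻¹ := by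
      rw [norm_mul, Complex.norm_of_nonneg ht0]
      gcongr
      exact le_mul_of_one_le_left ht0 hW1
    have hexp : -(x * s) * t - ((1 + s * Complex.I : ℂ) ^ 3).im / 3 * t ^ 3 + M * (s * t) ≤ K := by
      have h1 : ((1 + s * Complex.I : ℂ) ^ 3).im / 3 * t ^ 3 ≥ 2 * s / 3 * t ^ 3 := by gcongr
      have h2 : s * ((|x| + M) * t - 2 / 3 * t ^ 3) ≤ K := by
        have h3 : (|x| + M) * t - 2 / 3 * t ^ 3 ≤ K := by linarith [hK t ht0]
        have h4 := mul_le_mul_of_nonneg_left h3 hs.1.le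
        have h5 := mul_le_of_le_one_left hK0 hs.2.le
        linarith
      have h6 : -x * (s * t) ≤ |x| * (s * t) :=
        mul_le_mul_of_nonneg_right (neg_le_abs x) (mul_nonneg hs.1.le ht0)
      linarith
    rw [norm_mul, norm_mul, norm_airyPhase, one_add_mul_I_im]
    rw [him] at hF
    calc _ ≤ 2 * Real.exp (-(x * s) * t - ((1 + s * Complex.I : ℂ) ^ 3).im / 3 * t ^ 3) *
          (C * Real.exp (M * (s * t)) * (1 + t ^ 2)⁻¹) := by
          gcongr
          exact hF.trans (by gcongr)
      _ = 2 * C * Real.exp (-(x * s) * t - ((1 + s * Complex.I : ℂ) ^ 3).im / 3 * t ^ 3 +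
          M * (s * t)) * (1 + t ^ 2)⁻¹ := by rw [Real.exp_add]; ring
      _ ≤ _ := by gcongr
  · refine Eventually.of_forall fun t => ?_
    have h : Continuous fun s : ℝ => (1 + s * Complex.I) *
        airyPhase (1 + s * Complex.I) x t * fourierLaplace f ((1 + s * Complex.I) * t) := by
      fun_prop
    have h0 := (h.tendsto 0).mono_left (nhdsWithin_le_nhds (s := Set.Ioi 0))
    simpa using h0

/-- The Airy transform of a test function as a Fourier integral on the half line. -/
theorem integral_airy_mul_eq {A A' : ℝ → ℝ} (hA : ∀ x, HasDerivAt A (A' x) x)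
    (hA' : ∀ x, HasDerivAt A' (x * A x) x) (hlim : Tendsto A atTop (nhds 0))
    (h0 : A 0 = 1 / (3 ^ ((2 : ℝ) / 3) * Real.Gamma (2 / 3))) {f : ℝ → ℝ} (hf : ContDiff ℝ 2 f)
    (hs : HasCompactSupport f) (x : ℝ) :
    ∫ y, A (x + y) * f y =
      Real.pi⁻¹ * (∫ t in Set.Ioi (0 : ℝ), airyPhase 1 x t * fourierLaplace f t).re := by
  obtain ⟨M, hM⟩ := exists_support_bound hs
  have hlim' := ((Complex.continuous_re.tendsto _).comp
    (tendsto_integral_airyPhase hf hs x)).const_mul Real.pi⁻¹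
  refine tendsto_nhds_unique (tendsto_const_nhds.congr' ?_) hlim'
  filter_upwards [Ioo_mem_nhdsGT (one_pos (α := ℝ))] with s hs1
  have hw := one_add_mul_I_cube_im_pos hs1
  have hcont : Continuous (airyContour (1 + s * Complex.I)) :=
    continuous_iff_continuousAt.2 fun x => (hasDerivAt_airyContour hw x).continuousAt
  have hint : Integrable fun y => airyContour (1 + s * Complex.I) (x + y) * f y := by
    have := hf.continuous
    exact Continuous.integrable_of_hasCompactSupport (by fun_prop)
      ((hs.comp_left (g := fun r : ℝ => (r : ℂ)) Complex.ofReal_zero).mul_left)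
  simp only [Function.comp]
  rw [← integral_airyContour_mul hf.continuous hs hM hw, ← RCLike.re_eq_complex_re,
    ← integral_re hint, ← MeasureTheory.integral_const_mul]
  congr 1
  ext y
  rw [airy_eq_re_airyContour hA hA' hlim h0 hs1, RCLike.re_eq_complex_re, Complex.re_mul_ofReal,
    mul_assoc]

theorem hasTemperateGrowth_cexp_I_mul :
    Function.HasTemperateGrowth fun t : ℝ => Complex.exp (Complex.I * t) := by
  have hd : ∀ t : ℝ, HasDerivAt (fun t : ℝ => Complex.exp (Complex.I * t))
      (Complex.I * Complex.exp (Complex.I * t)) t := fun t => by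
    have h1 : HasDerivAt (fun t : ℝ => Complex.I * t) Complex.I t := by
      simpa using (Complex.ofRealCLM.hasDerivAt (x := t)).const_mul Complex.I
    exact h1.cexp.congr_deriv (mul_comm _ _)
  have hiter : ∀ n : ℕ, iteratedDeriv n (fun t : ℝ => Complex.exp (Complex.I * t)) =
      fun t : ℝ => Complex.I ^ n * Complex.exp (Complex.I * t) := fun n => by
    induction n with
    | zero => simp
    | succ n ih =>
      rw [iteratedDeriv_succ, ih]
      funext t
      rw [((hd t).const_mul _).deriv, pow_succ, mul_assoc]
  refine ⟨(contDiff_const.mul Complex.ofRealCLM.contDiff).cexp, fun n => ⟨0, 1, fun t => ?_⟩⟩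
  rw [norm_iteratedFDeriv_eq_norm_iteratedDeriv, hiter]
  simp [mul_comm Complex.I, Complex.norm_exp_ofReal_mul_I]

theorem hasTemperateGrowth_airyPhase :
    Function.HasTemperateGrowth fun ξ : ℝ => airyPhase 1 0 (2 * Real.pi * ξ) := by
  have hp : Function.HasTemperateGrowth fun ξ : ℝ => (2 * Real.pi) ^ 3 / 3 * ξ ^ 3 :=
    (Function.HasTemperateGrowth.const _).mul (Function.HasTemperateGrowth.id'.pow 3)
  convert hasTemperateGrowth_cexp_I_mul.comp hp using 1
  funext ξ
  simp only [airyPhase, Function.comp]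
  congr 1; push_cast; ring

theorem conj_airyPhase_one_mul_fourierLaplace (f : ℝ → ℝ) (x t : ℝ) :
    (starRingEnd ℂ) (airyPhase 1 x t * fourierLaplace f t) =
      airyPhase 1 x (-t) * fourierLaplace f (-t) := by
  rw [map_mul]
  congr 1
  · rw [airyPhase, airyPhase, ← Complex.exp_conj]
    congr 1
    simp [map_ofNat]; ring
  · rw [fourierLaplace, fourierLaplace, ← integral_conj]
    congr 1; ext y
    rw [map_mul, ← Complex.exp_conj]
    simp

/-- The Airy transform of a test function as a Fourier integral on the whole line. -/
theorem ofReal_integral_airy_mul_eq {A A' : ℝ → ℝ} (hA : ∀ x, HasDerivAt A (A' x) x)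
    (hA' : ∀ x, HasDerivAt A' (x * A x) x) (hlim : Tendsto A atTop (nhds 0))
    (h0 : A 0 = 1 / (3 ^ ((2 : ℝ) / 3) * Real.Gamma (2 / 3))) {f : ℝ → ℝ} (hf : ContDiff ℝ 2 f)
    (hs : HasCompactSupport f) (x : ℝ) :
    ((∫ y, A (x + y) * f y : ℝ) : ℂ) =
      ∫ ξ : ℝ, airyPhase 1 x (2 * Real.pi * ξ) * fourierLaplace f ((2 * Real.pi * ξ : ℝ) : ℂ) := by
  set k : ℝ → ℂ := fun t => airyPhase 1 x t * fourierLaplace f t with hk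
  have hint : Integrable k := integrable_airyPhase_one_mul_fourierLaplace hf hs x
  have hneg : ∫ t in Set.Iic (0 : ℝ), k t = (starRingEnd ℂ) (∫ t in Set.Ioi (0 : ℝ), k t) := by
    rw [← integral_conj, ← neg_zero, ← integral_comp_neg_Ioi]
    simp only [neg_zero, hk, conj_airyPhase_one_mul_fourierLaplace, Complex.ofReal_neg]
  have hsum : ∫ t, k t = ((2 * (∫ t in Set.Ioi (0 : ℝ), k t).re : ℝ) : ℂ) := by
    rw [← integral_Iic_add_Ioi hint.integrableOn hint.integrableOn (b := 0), hneg, add_comm,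
      Complex.add_conj]
  have hscale := Measure.integral_comp_mul_left k (2 * Real.pi)
  change _ = ∫ ξ : ℝ, k (2 * Real.pi * ξ)
  rw [hscale, hsum, integral_airy_mul_eq hA hA' hlim h0 hf hs,
    abs_of_pos (inv_pos.2 Real.two_pi_pos), Complex.real_smul, ← Complex.ofReal_mul]
  congr 1
  field_simp
  rfl

open scoped FourierTransform SchwartzMap in
/-- The Airy transform of a test function is a Schwartz function with the same `L²` norm. -/
theorem exists_schwartzMap_airy {A A' : ℝ → ℝ} (hA : ∀ x, HasDerivAt A (A' x) x)
    (hA' : ∀ x, HasDerivAt A' (x * A x) x) (hlim : Tendsto A atTop (nhds 0))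
    (h0 : A 0 = 1 / (3 ^ ((2 : ℝ) / 3) * Real.Gamma (2 / 3))) {f : ℝ → ℝ}
    (hf : ContDiff ℝ (⊤ : ℕ∞) f) (hs : HasCompactSupport f) :
    ∃ G : 𝓢(ℝ, ℂ), (∀ y, ((∫ z, A (y + z) * f z : ℝ) : ℂ) = G y) ∧
      ∫ y, ‖G y‖ ^ 2 = ∫ y, f y ^ 2 := by
  have hf2 : ContDiff ℝ 2 f := contDiff_infty.1 hf 2
  set φ : 𝓢(ℝ, ℂ) := HasCompactSupport.toSchwartzMap (f := fun y => (f y : ℂ))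
    (hs.comp_left (g := fun r : ℝ => (r : ℂ)) Complex.ofReal_zero)
    (Complex.ofRealCLM.contDiff.comp hf) with hφ
  set ψ : 𝓢(ℝ, ℂ) := 𝓕⁻ φ with hψ
  set G₀ : 𝓢(ℝ, ℂ) := SchwartzMap.smulLeftCLM ℂ
    (fun ξ : ℝ => airyPhase 1 0 (2 * Real.pi * ξ)) ψ with hG₀
  have hG₀_apply : ∀ ξ, G₀ ξ = airyPhase 1 0 (2 * Real.pi * ξ) * ψ ξ := fun ξ =>
    SchwartzMap.smulLeftCLM_apply_apply hasTemperateGrowth_airyPhase ψ ξ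
  have hψ_apply : ∀ ξ : ℝ, ψ ξ = fourierLaplace f ((2 * Real.pi * ξ : ℝ) : ℂ) := fun ξ => by
    rw [hψ, SchwartzMap.fourierInv_coe, Real.fourierInv_eq', fourierLaplace]
    congr 1; ext y
    rw [smul_eq_mul, mul_comm]
    congr 2
    simp; ring
  refine ⟨𝓕⁻ G₀, fun y => ?_, ?_⟩
  · rw [SchwartzMap.fourierInv_coe, Real.fourierInv_eq',
      ofReal_integral_airy_mul_eq hA hA' hlim h0 hf2 hs]
    congr 1; ext ξ
    rw [hG₀_apply, hψ_apply, smul_eq_mul, ← mul_assoc]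
    congr 1
    rw [airyPhase, airyPhase, ← Complex.exp_add]
    congr 1
    simp; ring
  · have h1 := SchwartzMap.integral_norm_sq_fourier (𝓕⁻ G₀)
    have h2 := SchwartzMap.integral_norm_sq_fourier ψ
    rw [FourierTransform.fourier_fourierInv_eq] at h1
    rw [hψ, FourierTransform.fourier_fourierInv_eq, ← hψ] at h2
    have h3 : ∀ y, ‖φ y‖ ^ 2 = f y ^ 2 := fun y => by
      change ‖(f y : ℂ)‖ ^ 2 = _
      rw [Complex.norm_real, Real.norm_eq_abs, sq_abs]
    have h4 : ∀ ξ, ‖G₀ ξ‖ ^ 2 = ‖ψ ξ‖ ^ 2 := fun ξ => by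
      rw [hG₀_apply, norm_mul, norm_airyPhase]; simp
    simp_rw [h3] at h2
    simp_rw [h4] at h1
    rw [← h1, ← h2]

theorem integral_add_sq {u v : ℝ → ℝ} (hu : MemLp u 2) (hv : MemLp v 2) :
    ∫ y, (u y + v y) ^ 2 = (∫ y, u y ^ 2) + 2 * (∫ y, u y * v y) + ∫ y, v y ^ 2 := by
  have huv : Integrable fun y => u y * v y := hu.integrable_mul hv
  have hsum : Integrable fun y => u y ^ 2 + 2 * (u y * v y) :=
    hu.integrable_sq.add (huv.const_mul 2)
  rw [← MeasureTheory.integral_const_mul, ← MeasureTheory.integral_add hu.integrable_sq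
    (huv.const_mul 2), ← MeasureTheory.integral_add hsum hv.integrable_sq]
  congr 1; ext y; ring

section AiryTransform

variable {A A' : ℝ → ℝ}

theorem continuous_airy_integral (hA : ∀ x, HasDerivAt A (A' x) x)
    (hA' : ∀ x, HasDerivAt A' (x * A x) x) (hlim : Tendsto A atTop (nhds 0)) {g : ℝ → ℝ}
    (hg : Integrable g) :
    (∀ x, Integrable fun y => A (x + y) * g y) ∧ Continuous fun x => ∫ y, A (x + y) * g y := by
  obtain ⟨C, hC⟩ := airy_solution_bounded hA hA' hlim
  have hcont : Continuous A := continuous_iff_continuousAt.2 fun x => (hA x).continuousAt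
  have hm : ∀ x, AEStronglyMeasurable fun y => A (x + y) * g y := fun x =>
    (Continuous.aestronglyMeasurable (by fun_prop)).mul hg.aestronglyMeasurable
  have hb : ∀ x y, ‖A (x + y) * g y‖ ≤ C * |g y| := fun x y => by
    rw [norm_mul, Real.norm_eq_abs, Real.norm_eq_abs]
    gcongr
    exact hC _
  refine ⟨fun x => (hg.abs.const_mul C).mono' (hm x) (Eventually.of_forall (hb x)), ?_⟩
  exact continuous_of_dominated hm (fun x => Eventually.of_forall (hb x)) (hg.abs.const_mul C)
    (Eventually.of_forall fun y => by fun_prop)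

theorem integrable_airy_transform (hA : ∀ x, HasDerivAt A (A' x) x)
    (hA' : ∀ x, HasDerivAt A' (x * A x) x) (hlim : Tendsto A atTop (nhds 0))
    (h0 : A 0 = 1 / (3 ^ ((2 : ℝ) / 3) * Real.Gamma (2 / 3))) {f : ℝ → ℝ}
    (hf : ContDiff ℝ (⊤ : ℕ∞) f) (hs : HasCompactSupport f) :
    Integrable (fun y => ∫ z, A (y + z) * f z) ∧
      MemLp (fun y => ∫ z, A (y + z) * f z) 2 ∧
      ∫ y, (∫ z, A (y + z) * f z) ^ 2 = ∫ z, f z ^ 2 := by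
  obtain ⟨G, hG, hGn⟩ := exists_schwartzMap_airy hA hA' hlim h0 hf hs
  have hre : (fun y => ∫ z, A (y + z) * f z) = fun y => RCLike.re (G y) := by
    funext y
    rw [← hG, RCLike.re_eq_complex_re, Complex.ofReal_re]
  refine ⟨?_, ?_, ?_⟩
  · rw [hre]; exact G.integrable.re
  · rw [hre]; exact (G.memLp 2).re
  · rw [← hGn]
    congr 1; ext y
    rw [← hG, Complex.norm_real, Real.norm_eq_abs, sq_abs]

theorem integral_airy_transform_mul (hA : ∀ x, HasDerivAt A (A' x) x)
    (hA' : ∀ x, HasDerivAt A' (x * A x) x) (hlim : Tendsto A atTop (nhds 0))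
    (h0 : A 0 = 1 / (3 ^ ((2 : ℝ) / 3) * Real.Gamma (2 / 3))) {f h : ℝ → ℝ}
    (hf : ContDiff ℝ (⊤ : ℕ∞) f) (hfs : HasCompactSupport f)
    (hh : ContDiff ℝ (⊤ : ℕ∞) h) (hhs : HasCompactSupport h) :
    ∫ y, (∫ z, A (y + z) * h z) * ∫ z, A (y + z) * f z = ∫ z, h z * f z := by
  have hfi := hf.continuous.integrable_of_hasCompactSupport hfs (μ := volume)
  have hhi := hh.continuous.integrable_of_hasCompactSupport hhs (μ := volume)
  obtain ⟨-, hf2, hfn⟩ := integrable_airy_transform hA hA' hlim h0 hf hfs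
  obtain ⟨-, hh2, hhn⟩ := integrable_airy_transform hA hA' hlim h0 hh hhs
  obtain ⟨-, -, hn⟩ := integrable_airy_transform hA hA' hlim h0 (hh.add hf) (hhs.add hfs)
  have hadd : ∀ y, ∫ z, A (y + z) * (h z + f z) =
      (∫ z, A (y + z) * h z) + ∫ z, A (y + z) * f z := fun y => by
    rw [← MeasureTheory.integral_add ((continuous_airy_integral hA hA' hlim hhi).1 y)
      ((continuous_airy_integral hA hA' hlim hfi).1 y)]
    simp only [mul_add]
  simp_rw [hadd] at hn
  rw [integral_add_sq hh2 hf2, integral_add_sq (hh.continuous.memLp_of_hasCompactSupport hhs)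
    (hf.continuous.memLp_of_hasCompactSupport hfs), hhn, hfn] at hn
  linarith

theorem integral_mul_airy_integral_comm (hA : ∀ x, HasDerivAt A (A' x) x)
    (hA' : ∀ x, HasDerivAt A' (x * A x) x) (hlim : Tendsto A atTop (nhds 0)) {g h : ℝ → ℝ}
    (hg : Integrable g) (hh : Integrable h) :
    ∫ z, h z * ∫ y, A (z + y) * g y = ∫ y, (∫ z, A (y + z) * h z) * g y := by
  obtain ⟨C, hC⟩ := airy_solution_bounded hA hA' hlim
  have hcont : Continuous A := continuous_iff_continuousAt.2 fun x => (hA x).continuousAt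
  have hint : Integrable (Function.uncurry fun z y => A (z + y) * (h z * g y))
      (volume.prod volume) :=
    (hh.mul_prod hg).bdd_mul (Continuous.aestronglyMeasurable (by fun_prop))
      (Eventually.of_forall fun p => hC (p.1 + p.2))
  have hswap := integral_integral_swap hint
  calc _ = ∫ z, ∫ y, A (z + y) * (h z * g y) := by
        simp_rw [← MeasureTheory.integral_const_mul]
        congr 1; ext z; congr 1; ext y; ring
    _ = ∫ y, ∫ z, A (z + y) * (h z * g y) := hswap
    _ = _ := by
        simp_rw [← MeasureTheory.integral_mul_const]
        congr 1; ext y; congr 1; ext z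
        rw [add_comm z y]; ring

/-- The Airy transform is an involution on test functions. -/
theorem airy_transform_airy_transform (hA : ∀ x, HasDerivAt A (A' x) x)
    (hA' : ∀ x, HasDerivAt A' (x * A x) x) (hlim : Tendsto A atTop (nhds 0))
    (h0 : A 0 = 1 / (3 ^ ((2 : ℝ) / 3) * Real.Gamma (2 / 3))) {f : ℝ → ℝ}
    (hf : ContDiff ℝ (⊤ : ℕ∞) f) (hs : HasCompactSupport f) (x : ℝ) :
    ∫ y, A (x + y) * ∫ z, A (y + z) * f z = f x := by
  have hg := (integrable_airy_transform hA hA' hlim h0 hf hs).1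
  have hcont := (continuous_airy_integral hA hA' hlim hg).2
  have hae := ae_eq_of_integral_contDiff_smul_eq (μ := volume) hcont.locallyIntegrable
    hf.continuous.locallyIntegrable fun h hh hhs => by
      simp only [smul_eq_mul]
      rw [integral_mul_airy_integral_comm hA hA' hlim hg
        (hh.continuous.integrable_of_hasCompactSupport hhs),
        integral_airy_transform_mul hA hA' hlim h0 hf hs hh hhs]
  exact congrFun ((Continuous.ae_eq_iff_eq volume hcont hf.continuous).1 hae) x

end AiryTransform

/-- The scalar Airy convolution operator `𝓛` with `(𝓛 f)(x) = ∫ Ai(x+y) f(y) dy` squares to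
the identity: here `Ai` is characterized as the unique solution of `Ai'' = x·Ai` decaying at
`+∞` with `Ai(0) = 1/(3^{2/3} Γ(2/3))`.  For every test function `f` (smooth with compact
support) and every `x`, `(𝓛(𝓛 f))(x) = f(x)` (the outer integral as an improper integral),
and `𝓛` preserves the `L²` norm; in particular `𝓛` is a unitary involution of norm 1. -/
theorem airy_convolution_squares_to_id
    (Ai : ℝ → ℝ) (hdiff : Differentiable ℝ Ai)
    (hODE : ∀ x, HasDerivAt (deriv Ai) (x * Ai x) x)
    (hdecay : Tendsto Ai atTop (nhds 0))
    (hnorm : Ai 0 = 1 / (3 ^ ((2 : ℝ) / 3) * Real.Gamma (2 / 3))) :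
    ∀ f : ℝ → ℝ, ContDiff ℝ (⊤ : ℕ∞) f → HasCompactSupport f →
      (∀ x : ℝ,
        Tendsto (fun R : ℝ => ∫ y in (-R)..R, Ai (x + y) * ∫ z, Ai (y + z) * f z)
          atTop (nhds (f x))) ∧
      (∫ y, (∫ z, Ai (y + z) * f z) ^ 2) = ∫ z, (f z) ^ 2 := by
  intro f hf hs
  have hA : ∀ x, HasDerivAt Ai (deriv Ai x) x := fun x => (hdiff x).hasDerivAt
  obtain ⟨hg, -, hn⟩ := integrable_airy_transform hA hODE hdecay hnorm hf hs
  refine ⟨fun x => ?_, hn⟩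
  rw [← airy_transform_airy_transform hA hODE hdecay hnorm hf hs x]
  exact intervalIntegral_tendsto_integral ((continuous_airy_integral hA hODE hdecay hg).1 x)
    tendsto_neg_atTop_atBot tendsto_id
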